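/- Let k ≥ 1 and let Q_0, …, Q_k ∈ ℂ[x] with deg Q_k ≥ 1, let T(p) = ∑_{j=0}^k Q_j · p^{(j)}, and assume T is non-degenerate, i.e. deg Q_j − j ≤ deg Q_k − k for all 0 ≤ j ≤ k with Q_j ≠ 0. Then the intersection, over all integers n ≥ 0 and all nonempty closed T_{≥n}-invariant sets S ⊆ ℂ, of the sets S equals the convex hull of the set of complex zeros of Q_k. Equivalently, with M_{≥n} denoting the intersection of all nonempty closed T_{≥n}-invariant sets, one has ⋂_{n≥0} M_{≥n} = Conv(Q_k). -/

import Mathlib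

open Polynomial

/-- The differential operator `T(p) = ∑_{j=0}^k Q_j · p^{(j)}`. -/
noncomputable def diffOp (k : ℕ) (Q : ℕ → Polynomial ℂ) (p : Polynomial ℂ) : Polynomial ℂ :=
  ∑ j ∈ Finset.range (k + 1), Q j * (⇑(Polynomial.derivative (R := ℂ)))^[j] p

/-- A set `S ⊆ ℂ` is `T_{≥n}`-invariant: for every nonzero polynomial `p` with `deg p ≥ n`
all of whose zeros lie in `S`, either `T p = 0` or all zeros of `T p` lie in `S`. -/
def TGeInvariant (T : Polynomial ℂ → Polynomial ℂ) (n : ℕ) (S : Set ℂ) : Prop :=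
  ∀ p : Polynomial ℂ, p ≠ 0 → n ≤ p.natDegree → (∀ z : ℂ, p.eval z = 0 → z ∈ S) →
    T p = 0 ∨ ∀ z : ℂ, (T p).eval z = 0 → z ∈ S

/-- `T` is non-degenerate: `deg Q_j − j ≤ deg Q_k − k` for all `0 ≤ j ≤ k` with `Q_j ≠ 0`. -/
def NonDegenerate (k : ℕ) (Q : ℕ → Polynomial ℂ) : Prop :=
  ∀ j ≤ k, Q j ≠ 0 → ((Q j).natDegree : ℤ) - j ≤ ((Q k).natDegree : ℤ) - k

open Filter Topology

/-- Coefficientwise convergence of a sequence of polynomials of bounded degree. -/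
def BoundedCoeffTendsto (g : ℕ → ℂ[X]) (f : ℂ[X]) : Prop :=
  (∃ d, ∀ N, (g N).natDegree ≤ d) ∧ ∀ i, Tendsto (fun N => (g N).coeff i) atTop (𝓝 (f.coeff i))

namespace BoundedCoeffTendsto

variable {g g' : ℕ → ℂ[X]} {f f' : ℂ[X]}

theorem const (f : ℂ[X]) : BoundedCoeffTendsto (fun _ => f) f :=
  ⟨⟨f.natDegree, fun _ => le_rfl⟩, fun _ => tendsto_const_nhds⟩

theorem constantCoeff {c : ℕ → ℂ} {a : ℂ} (h : Tendsto c atTop (𝓝 a)) :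
    BoundedCoeffTendsto (fun N => C (c N)) (C a) := by
  refine ⟨⟨0, fun N => by simp⟩, fun i => ?_⟩
  rcases eq_or_ne i 0 with rfl | hi
  · simpa using h
  · simp [coeff_C, hi]

theorem add (h : BoundedCoeffTendsto g f) (h' : BoundedCoeffTendsto g' f') :
    BoundedCoeffTendsto (fun N => g N + g' N) (f + f') := by
  obtain ⟨⟨d, hd⟩, h⟩ := h
  obtain ⟨⟨d', hd'⟩, h'⟩ := h'
  refine ⟨⟨max d d', fun N => (natDegree_add_le _ _).trans (max_le_max (hd N) (hd' N))⟩,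
    fun i => ?_⟩
  simpa using (h i).add (h' i)

theorem mul (h : BoundedCoeffTendsto g f) (h' : BoundedCoeffTendsto g' f') :
    BoundedCoeffTendsto (fun N => g N * g' N) (f * f') := by
  obtain ⟨⟨d, hd⟩, h⟩ := h
  obtain ⟨⟨d', hd'⟩, h'⟩ := h'
  refine ⟨⟨d + d', fun N => natDegree_mul_le.trans (add_le_add (hd N) (hd' N))⟩, fun i => ?_⟩
  simp only [coeff_mul]
  exact tendsto_finsetSum _ fun ij _ => (h ij.1).mul (h' ij.2)

theorem sum {ι : Type*} (s : Finset ι) {g : ι → ℕ → ℂ[X]} {f : ι → ℂ[X]}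
    (h : ∀ i ∈ s, BoundedCoeffTendsto (g i) (f i)) :
    BoundedCoeffTendsto (fun N => ∑ i ∈ s, g i N) (∑ i ∈ s, f i) := by
  classical
  induction s using Finset.induction_on with
  | empty => simpa using const 0
  | insert a s ha ih =>
    simp only [Finset.sum_insert ha]
    exact (h a (Finset.mem_insert_self a s)).add
      (ih fun i hi => h i (Finset.mem_insert_of_mem hi))

theorem derivative (h : BoundedCoeffTendsto g f) :
    BoundedCoeffTendsto (fun N => Polynomial.derivative (g N)) (Polynomial.derivative f) := by
  obtain ⟨⟨d, hd⟩, h⟩ := h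
  refine ⟨⟨d, fun N => (natDegree_derivative_le _).trans ((Nat.sub_le _ _).trans (hd N))⟩,
    fun i => ?_⟩
  simp only [coeff_derivative]
  exact (h (i + 1)).mul_const _

theorem eval (h : BoundedCoeffTendsto g f) (x : ℂ) :
    Tendsto (fun N => (g N).eval x) atTop (𝓝 (f.eval x)) := by
  obtain ⟨⟨d, hd⟩, h⟩ := h
  set m := max d f.natDegree + 1
  have hg (N : ℕ) : (g N).eval x = ∑ i ∈ Finset.range m, (g N).coeff i * x ^ i :=
    eval_eq_sum_range' (by have := hd N; omega) x
  simp only [hg]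
  rw [eval_eq_sum_range' (show f.natDegree < m by omega) x]
  exact tendsto_finsetSum _ fun i _ => (h i).mul_const _

end BoundedCoeffTendsto

/-- A polynomial without zeros in `ball ξ r` grows by a factor of at most `2 ^ deg` on that ball. -/
theorem norm_eval_le_two_pow_of_no_root {g : ℂ[X]} {ξ x : ℂ} {r : ℝ}
    (hg : ∀ z ∈ Metric.ball ξ r, g.eval z ≠ 0) (hx : x ∈ Metric.ball ξ r) :
    ‖g.eval x‖ ≤ 2 ^ g.natDegree * ‖g.eval ξ‖ := by
  have hs := IsAlgClosed.splits g
  have key (s : Multiset ℂ) (hroots : ∀ z ∈ s, z ∉ Metric.ball ξ r) :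
      ‖(s.map (x - ·)).prod‖ ≤ 2 ^ Multiset.card s * ‖(s.map (ξ - ·)).prod‖ := by
    induction s using Multiset.induction_on with
    | empty => simp
    | cons a s ih =>
      have ih' := ih fun z hz => hroots z (Multiset.mem_cons_of_mem hz)
      have ha : r ≤ ‖ξ - a‖ := by
        have := hroots a (Multiset.mem_cons_self a s)
        rwa [Metric.mem_ball, not_lt, dist_comm, dist_eq_norm] at this
      have hx' : ‖x - ξ‖ < r := by rwa [Metric.mem_ball, dist_eq_norm] at hx
      have hxa : ‖x - a‖ ≤ 2 * ‖ξ - a‖ := by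
        have := norm_add_le (x - ξ) (ξ - a)
        rw [sub_add_sub_cancel] at this
        linarith
      simp only [Multiset.map_cons, Multiset.prod_cons, norm_mul, Multiset.card_cons, pow_succ]
      calc _ ≤ (2 * ‖ξ - a‖) * (2 ^ Multiset.card s * ‖(s.map (ξ - ·)).prod‖) := by gcongr
        _ = _ := by ring
  have := key g.roots fun z hz hzb => hg z hzb (isRoot_of_mem_roots hz)
  rw [hs.eval_eq_prod_roots, hs.eval_eq_prod_roots ξ, norm_mul, norm_mul,
    hs.natDegree_eq_card_roots]
  calc _ ≤ _ := mul_le_mul_of_nonneg_left this (norm_nonneg _)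
    _ = _ := by ring

/-- The Hurwitz theorem for polynomials of bounded degree. -/
theorem BoundedCoeffTendsto.eventually_exists_root {g : ℕ → ℂ[X]} {f : ℂ[X]}
    (h : BoundedCoeffTendsto g f) (hf : f ≠ 0) {ξ : ℂ} (hξ : f.eval ξ = 0) {r : ℝ} (hr : 0 < r) :
    ∀ᶠ N in atTop, g N ≠ 0 ∧ ∃ z ∈ Metric.ball ξ r, (g N).eval z = 0 := by
  obtain ⟨x, hx, hfx⟩ : ∃ x ∈ Metric.ball ξ r, f.eval x ≠ 0 := by
    by_contra! hall
    have hinf : (Metric.ball ξ r).Infinite := infinite_of_mem_nhds ξ (Metric.ball_mem_nhds ξ hr)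
    exact hf (eq_zero_of_infinite_isRoot f (hinf.mono fun z hz => hall z hz))
  obtain ⟨d, hd⟩ := h.1
  have hlim : Tendsto (fun N => ‖(g N).eval x‖ - 2 ^ d * ‖(g N).eval ξ‖) atTop
      (𝓝 (‖f.eval x‖ - 2 ^ d * ‖f.eval ξ‖)) :=
    (h.eval x).norm.sub ((h.eval ξ).norm.const_mul _)
  have hpos : 0 < ‖f.eval x‖ - 2 ^ d * ‖f.eval ξ‖ := by simpa [hξ] using hfx
  filter_upwards [hlim.eventually_const_lt hpos] with N hN
  refine ⟨fun h0 => by simp [h0] at hN, ?_⟩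
  by_contra! hall
  have h1 := norm_eval_le_two_pow_of_no_root hall hx
  have h2 : (2 : ℝ) ^ (g N).natDegree * ‖(g N).eval ξ‖ ≤ 2 ^ d * ‖(g N).eval ξ‖ := by
    gcongr
    · norm_num
    · exact hd N
  linarith

/-- The polynomials `r_j` with `p ^ j * (p ^ N)^{(j)} = N ^ j * p ^ N * r_j`. -/
noncomputable def powDerivFactor (p : ℂ[X]) : ℕ → ℕ → ℂ[X]
  | 0, _ => 1
  | j + 1, N => C (1 - (j : ℂ) / N) * (derivative p * powDerivFactor p j N) +
      C ((1 : ℂ) / N) * (p * derivative (powDerivFactor p j N))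

theorem pow_mul_iterate_derivative_pow (p : ℂ[X]) (j : ℕ) {N : ℕ} (hN : N ≠ 0) :
    p ^ j * derivative^[j] (p ^ N) = C ((N : ℂ) ^ j) * p ^ N * powDerivFactor p j N := by
  induction j with
  | zero => simp [powDerivFactor]
  | succ j ih =>
    have hpow (m : ℕ) : p * derivative (p ^ m) = C (m : ℂ) * p ^ m * derivative p := by
      cases m with
      | zero => simp
      | succ m => rw [derivative_pow, Nat.add_sub_cancel]; ring
    have hd := congrArg (fun q => p * derivative q) ih
    simp only [derivative_mul, derivative_C, zero_mul, zero_add] at hd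
    have hj := hpow j
    have hNp := hpow N
    have hN' : (N : ℂ) ≠ 0 := Nat.cast_ne_zero.mpr hN
    have h1 : C ((N : ℂ) ^ (j + 1)) * C (1 - (j : ℂ) / N) =
        C ((N : ℂ) ^ j) * (C (N : ℂ) - C (j : ℂ)) := by
      rw [← C_mul, ← C_sub, ← C_mul, pow_succ]; congr 1; field_simp
    have h2 : C ((N : ℂ) ^ (j + 1)) * C ((1 : ℂ) / N) = C ((N : ℂ) ^ j) := by
      rw [← C_mul, pow_succ]; congr 1; field_simp
    rw [Function.iterate_succ_apply', powDerivFactor]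
    linear_combination hd - derivative^[j] (p ^ N) * hj - C (j : ℂ) * derivative p * ih
      + C ((N : ℂ) ^ j) * powDerivFactor p j N * hNp
      - p ^ N * derivative p * powDerivFactor p j N * h1
      - p ^ N * p * derivative (powDerivFactor p j N) * h2

theorem tendsto_powDerivFactor (p : ℂ[X]) (j : ℕ) :
    BoundedCoeffTendsto (powDerivFactor p j) (derivative p ^ j) := by
  induction j with
  | zero => simpa [powDerivFactor] using BoundedCoeffTendsto.const 1
  | succ j ih =>
    have h1 : Tendsto (fun N : ℕ => 1 - (j : ℂ) / N) atTop (𝓝 (1 - 0)) :=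
      tendsto_const_nhds.sub (tendsto_const_div_atTop_nhds_zero_nat (j : ℂ))
    have h2 : Tendsto (fun N : ℕ => (1 : ℂ) / N) atTop (𝓝 0) :=
      tendsto_const_div_atTop_nhds_zero_nat (1 : ℂ)
    have := ((BoundedCoeffTendsto.constantCoeff h1).mul
      ((BoundedCoeffTendsto.const (derivative p)).mul ih)).add
      ((BoundedCoeffTendsto.constantCoeff h2).mul
        ((BoundedCoeffTendsto.const p).mul ih.derivative))
    rwa [sub_zero, C_1, one_mul, C_0, zero_mul, add_zero, ← pow_succ'] at this

/-- A polynomial with `p ^ k * T (p ^ N) = N ^ k * p ^ N * diffOpPowFactor k Q p N`. -/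
noncomputable def diffOpPowFactor (k : ℕ) (Q : ℕ → ℂ[X]) (p : ℂ[X]) (N : ℕ) : ℂ[X] :=
  ∑ j ∈ Finset.range (k + 1),
    C (((1 : ℂ) / N) ^ (k - j)) * (Q j * p ^ (k - j) * powDerivFactor p j N)

theorem pow_mul_diffOp_pow (k : ℕ) (Q : ℕ → ℂ[X]) (p : ℂ[X]) {N : ℕ} (hN : N ≠ 0) :
    p ^ k * diffOp k Q (p ^ N) = C ((N : ℂ) ^ k) * p ^ N * diffOpPowFactor k Q p N := by
  rw [diffOp, diffOpPowFactor, Finset.mul_sum, Finset.mul_sum]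
  refine Finset.sum_congr rfl fun j hj => ?_
  obtain ⟨i, rfl⟩ := Nat.exists_eq_add_of_le (Finset.mem_range_succ_iff.mp hj)
  have hN' : (N : ℂ) ≠ 0 := Nat.cast_ne_zero.mpr hN
  have h1 : C ((N : ℂ) ^ (j + i)) * C (((1 : ℂ) / N) ^ i) = C ((N : ℂ) ^ j) := by
    rw [← C_mul, one_div, inv_pow, pow_add, mul_inv_cancel_right₀ (pow_ne_zero i hN')]
  rw [Nat.add_sub_cancel_left]
  linear_combination p ^ i * Q j * pow_mul_iterate_derivative_pow p j hN
    - p ^ N * Q j * p ^ i * powDerivFactor p j N * h1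

theorem tendsto_diffOpPowFactor (k : ℕ) (Q : ℕ → ℂ[X]) (p : ℂ[X]) :
    BoundedCoeffTendsto (diffOpPowFactor k Q p) (Q k * derivative p ^ k) := by
  have h (j : ℕ) : BoundedCoeffTendsto
      (fun N => C (((1 : ℂ) / N) ^ (k - j)) * (Q j * p ^ (k - j) * powDerivFactor p j N))
      (C ((0 : ℂ) ^ (k - j)) * (Q j * p ^ (k - j) * derivative p ^ j)) :=
    (BoundedCoeffTendsto.constantCoeff
      ((tendsto_const_div_atTop_nhds_zero_nat (1 : ℂ)).pow (k - j))).mul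
      ((BoundedCoeffTendsto.const _).mul (tendsto_powDerivFactor p j))
  have hlim : ∑ j ∈ Finset.range (k + 1), C ((0 : ℂ) ^ (k - j)) *
      (Q j * p ^ (k - j) * derivative p ^ j) = Q k * derivative p ^ k := by
    rw [Finset.sum_range_succ, Finset.sum_eq_zero]
    · simp
    · intro j hj
      have : k - j ≠ 0 := by have := Finset.mem_range.mp hj; omega
      simp [this]
  rw [← hlim]
  exact BoundedCoeffTendsto.sum (Finset.range (k + 1)) fun j _ => h j

theorem TGeInvariant.mem_of_eval_eq_zero {k n : ℕ} {Q : ℕ → ℂ[X]} {S : Set ℂ}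
    (hS : TGeInvariant (diffOp k Q) n S) (hcl : IsClosed S) {p : ℂ[X]} (hp : 1 ≤ p.natDegree)
    (hpS : ∀ z, p.eval z = 0 → z ∈ S) (hQ : Q k ≠ 0) {ξ : ℂ}
    (hξ : (Q k * derivative p ^ k).eval ξ = 0) : ξ ∈ S := by
  by_contra hξS
  obtain ⟨r, hr, hball⟩ := Metric.isOpen_iff.mp hcl.isOpen_compl ξ hξS
  have hp0 : p ≠ 0 := by rintro rfl; simp at hp
  have hp' : derivative p ≠ 0 := fun h => by
    have := derivative_eq_zero.mp h
    omega
  obtain ⟨N, ⟨hg0, z, hz, hgz⟩, hN⟩ :=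
    (((tendsto_diffOpPowFactor k Q p).eventually_exists_root
      (mul_ne_zero hQ (pow_ne_zero k hp')) hξ hr).and (eventually_ge_atTop (n + 1))).exists
  have hN0 : N ≠ 0 := by omega
  have hid := pow_mul_diffOp_pow k Q p hN0
  have hpz : p.eval z ≠ 0 := fun h => hball hz (hpS z h)
  have hdeg : n ≤ (p ^ N).natDegree := by
    rw [natDegree_pow]
    nlinarith
  rcases hS (p ^ N) (pow_ne_zero N hp0) hdeg
    (fun w hw => hpS w (eq_zero_of_pow_eq_zero (by simpa using hw))) with h0 | hroots
  · rw [h0, mul_zero, eq_comm] at hid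
    have : C ((N : ℂ) ^ k) ≠ 0 := C_ne_zero.mpr (pow_ne_zero k (Nat.cast_ne_zero.mpr hN0))
    exact mul_ne_zero (mul_ne_zero this (pow_ne_zero N hp0)) hg0 hid
  · refine hball hz (hroots z ?_)
    have := congrArg (Polynomial.eval z) hid
    rw [eval_mul, eval_mul, hgz, mul_zero, eval_pow] at this
    exact (mul_eq_zero.mp this).resolve_left (pow_ne_zero k hpz)

theorem convex_of_isClosed_of_midpoint_mem {S : Set ℂ} (hcl : IsClosed S)
    (hmid : ∀ x ∈ S, ∀ y ∈ S, midpoint ℝ x y ∈ S) : Convex ℝ S := by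
  rw [convex_iff_segment_subset]
  intro x hx y hy
  rw [segment_eq_image_lineMap]
  rintro _ ⟨t, ht, rfl⟩
  by_contra htS
  set A : Set ℝ := AffineMap.lineMap x y ⁻¹' S
  have hA : IsClosed A := hcl.preimage (AffineMap.lineMap_continuous)
  obtain ⟨a, ⟨ha, hat⟩, hamax⟩ := (isCompact_Icc.inter_left hA).exists_isGreatest
    (⟨0, by simpa [A] using hx, le_rfl, ht.1⟩ : (A ∩ Set.Icc 0 t).Nonempty)
  obtain ⟨b, ⟨hb, hbt⟩, hbmin⟩ := (isCompact_Icc.inter_left hA).exists_isLeast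
    (⟨1, by simpa [A] using hy, ht.2, le_rfl⟩ : (A ∩ Set.Icc t 1).Nonempty)
  have hat' : a < t := lt_of_le_of_ne hat.2 fun h => htS (h ▸ ha)
  have hbt' : t < b := lt_of_le_of_ne hbt.1 fun h => htS (h ▸ hb)
  have hm : (a + b) / 2 ∈ A := by
    have := hmid _ ha _ hb
    rw [← AffineMap.map_midpoint] at this
    have hab : midpoint ℝ a b = (a + b) / 2 := by
      rw [midpoint_eq_smul_add, smul_eq_mul, invOf_eq_inv]; ring
    rwa [hab] at this
  rcases le_total ((a + b) / 2) t with h | h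
  · have := hamax ⟨hm, by linarith [hat.1], h⟩
    linarith
  · have := hbmin ⟨hm, h, by linarith [hbt.2]⟩
    linarith

theorem TGeInvariant.convexHull_subset {k n : ℕ} (hk : 1 ≤ k) {Q : ℕ → ℂ[X]} (hQ : Q k ≠ 0)
    {S : Set ℂ} (hne : S.Nonempty) (hcl : IsClosed S) (hS : TGeInvariant (diffOp k Q) n S) :
    convexHull ℝ {z : ℂ | (Q k).eval z = 0} ⊆ S := by
  refine convexHull_min (fun ξ hξ => ?_) (convex_of_isClosed_of_midpoint_mem hcl ?_)
  · obtain ⟨α, hα⟩ := hne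
    refine hS.mem_of_eval_eq_zero hcl (p := X - C α) (by simp) (fun z hz => ?_) hQ ?_
    · rw [eval_sub, eval_X, eval_C, sub_eq_zero] at hz
      exact hz ▸ hα
    · rw [eval_mul, show (Q k).eval ξ = 0 from hξ, zero_mul]
  · intro α hα β hβ
    refine hS.mem_of_eval_eq_zero hcl (p := (X - C α) * (X - C β)) ?_ (fun z hz => ?_) hQ ?_
    · rw [natDegree_mul (X_sub_C_ne_zero α) (X_sub_C_ne_zero β)]
      simp
    · simp only [eval_mul, eval_sub, eval_X, eval_C, mul_eq_zero, sub_eq_zero] at hz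
      rcases hz with rfl | rfl <;> assumption
    · have : midpoint ℝ α β = (α + β) / 2 := by
        rw [midpoint_eq_smul_add, Complex.real_smul, invOf_eq_inv]; push_cast; ring
      have h0 : (derivative ((X - C α) * (X - C β))).eval (midpoint ℝ α β) = 0 := by
        rw [this]; simp; ring
      rw [eval_mul, eval_pow, h0, zero_pow (by omega), mul_zero]

/-- A point outside a bounded closed convex set is cut off from it by a disk. -/
theorem exists_closedBall_of_notMem {K : Set ℂ} (hne : K.Nonempty) (hcl : IsCompact K)
    (hconv : Convex ℝ K) {z : ℂ} (hz : z ∉ K) :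
    ∃ (c : ℂ) (R' R : ℝ), 0 ≤ R' ∧ R' < R ∧ K ⊆ Metric.closedBall c R' ∧
      z ∉ Metric.closedBall c R := by
  obtain ⟨w, hw, hmin⟩ := exists_norm_eq_iInf_of_complete_convex hne hcl.isComplete hconv z
  rw [norm_eq_iInf_iff_real_inner_le_zero hconv hw] at hmin
  obtain ⟨D, hD⟩ := hcl.isBounded.subset_closedBall w
  have hv : 0 < ‖z - w‖ := norm_pos_iff.mpr (sub_ne_zero.mpr fun h => hz (h ▸ hw))
  set t : ℝ := D ^ 2 / ‖z - w‖ ^ 2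
  have ht0 : 0 ≤ t := by positivity
  have htv : t * ‖z - w‖ ^ 2 = D ^ 2 := div_mul_cancel₀ _ (by positivity)
  set c : ℂ := w - t • (z - w) with hc
  have hzc : ‖z - c‖ = (1 + t) * ‖z - w‖ := by
    have : z - c = (1 + t) • (z - w) := by rw [hc, add_smul, one_smul]; ring
    rw [this, norm_smul, Real.norm_of_nonneg (by positivity)]
  set R' : ℝ := √(D ^ 2 + t ^ 2 * ‖z - w‖ ^ 2) with hR'
  have hlt : R' < ‖z - c‖ := by
    rw [hR', hzc]
    apply Real.sqrt_lt' (by positivity) |>.mpr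
    nlinarith [pow_pos hv 2]
  refine ⟨c, R', (R' + ‖z - c‖) / 2, Real.sqrt_nonneg _, by linarith, fun y hy => ?_, ?_⟩
  · rw [Metric.mem_closedBall, dist_eq_norm]
    apply Real.le_sqrt_of_sq_le
    have hyc : y - c = (y - w) + t • (z - w) := by rw [hc]; ring
    have hyD : ‖y - w‖ ≤ D := by simpa [dist_eq_norm] using hD hy
    have hin := hmin y hy
    rw [hyc, norm_add_sq_real, real_inner_smul_right, real_inner_comm, norm_smul, mul_pow,
      Real.norm_eq_abs, sq_abs]
    nlinarith [norm_nonneg (y - w)]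
  · rw [Metric.mem_closedBall, dist_eq_norm]
    linarith

theorem natDegree_mul_norm_eval_le {p : ℂ[X]} {c u : ℂ} {R : ℝ}
    (hp : ∀ z, p.eval z = 0 → z ∈ Metric.closedBall c R) (hu : u ∉ Metric.closedBall c R) :
    p.natDegree * ‖p.eval u‖ ≤ 2 * ‖u - c‖ * ‖(derivative p).eval u‖ := by
  have hs := IsAlgClosed.splits p
  have hpu : p.eval u ≠ 0 := fun h => hu (hp u h)
  have hu' : R < ‖u - c‖ := by simpa [dist_eq_norm] using hu
  have key (s : Multiset ℂ) (hroots : ∀ z ∈ s, z ∈ Metric.closedBall c R) :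
      (Multiset.card s : ℝ) ≤ 2 * ((u - c) * (s.map fun z => 1 / (u - z)).sum).re := by
    induction s using Multiset.induction_on with
    | empty => simp
    | cons a s ih =>
      have ih' := ih fun z hz => hroots z (Multiset.mem_cons_of_mem hz)
      have ha : ‖a - c‖ < ‖u - c‖ := by
        have := hroots a (Multiset.mem_cons_self a s)
        rw [Metric.mem_closedBall, dist_eq_norm] at this
        linarith
      have hua : u - a ≠ 0 := sub_ne_zero.mpr fun h => by simp [h] at ha
      have hterm : 1 ≤ 2 * ((u - c) * (1 / (u - a))).re := by
        have hpos : 0 < Complex.normSq (u - a) := Complex.normSq_pos.mpr hua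
        have hsq : Complex.normSq (a - c) ≤ Complex.normSq (u - c) := by
          rw [Complex.normSq_eq_norm_sq, Complex.normSq_eq_norm_sq]
          gcongr
        have : 2 * ((u - c) * (1 / (u - a))).re
            = 2 * ((u - c).re * (u - a).re + (u - c).im * (u - a).im) / Complex.normSq (u - a) := by
          rw [one_div, Complex.mul_re, Complex.inv_re, Complex.inv_im]; ring
        rw [this, le_div_iff₀ hpos]
        simp only [Complex.normSq_apply, Complex.sub_re, Complex.sub_im] at hsq ⊢
        nlinarith
      simp only [Multiset.map_cons, Multiset.sum_cons, Multiset.card_cons, mul_add,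
        Complex.add_re]
      push_cast
      linarith
  have h1 := key p.roots fun z hz => hp z (isRoot_of_mem_roots hz)
  rw [← hs.eval_derivative_div_eval_of_ne_zero hpu, ← hs.natDegree_eq_card_roots] at h1
  have h2 := Complex.re_le_norm ((u - c) * ((derivative p).eval u / p.eval u))
  rw [norm_mul, norm_div] at h2
  have h3 : (p.natDegree : ℝ) ≤ 2 * ‖u - c‖ * ‖(derivative p).eval u‖ / ‖p.eval u‖ := by
    rw [mul_div_assoc]; linarith
  rwa [le_div_iff₀ (norm_pos_iff.mpr hpu)] at h3

/-- If `p` has no zeros outside a disk, neither do its derivatives of order at most `deg p`. -/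
theorem iterate_derivative_roots_mem_closedBall {p : ℂ[X]} {c : ℂ} {R : ℝ}
    (hp : ∀ z, p.eval z = 0 → z ∈ Metric.closedBall c R) {j : ℕ} (hj : j ≤ p.natDegree) :
    (derivative^[j] p).natDegree = p.natDegree - j ∧
      ∀ z, (derivative^[j] p).eval z = 0 → z ∈ Metric.closedBall c R := by
  induction j with
  | zero => exact ⟨rfl, hp⟩
  | succ j ih =>
    obtain ⟨hdeg, hroots⟩ := ih (by omega)
    rw [Function.iterate_succ_apply']
    refine ⟨by rw [natDegree_derivative, hdeg]; omega, fun z hz => ?_⟩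
    by_contra hzb
    have h := natDegree_mul_norm_eval_le hroots hzb
    rw [hz, norm_zero, mul_zero, hdeg] at h
    have h1 : (0 : ℝ) < (p.natDegree - j : ℕ) := by
      exact_mod_cast Nat.sub_pos_of_lt (by omega : j < p.natDegree)
    have h2 : 0 < ‖(derivative^[j] p).eval z‖ := norm_pos_iff.mpr fun h => hzb (hroots z h)
    nlinarith [mul_pos h1 h2]

theorem pow_mul_norm_eval_iterate_derivative_le {p : ℂ[X]} {c u : ℂ} {R : ℝ}
    (hp : ∀ z, p.eval z = 0 → z ∈ Metric.closedBall c R) (hu : u ∉ Metric.closedBall c R)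
    (j i : ℕ) (hij : j + i ≤ p.natDegree) :
    ((p.natDegree - (j + i) : ℕ) : ℝ) ^ i * ‖(derivative^[j] p).eval u‖ ≤
      (2 * ‖u - c‖) ^ i * ‖(derivative^[j + i] p).eval u‖ := by
  induction i with
  | zero => simp
  | succ i ih =>
    obtain ⟨hdeg, hroots⟩ := iterate_derivative_roots_mem_closedBall hp
      (show j + i ≤ p.natDegree by omega)
    have h := natDegree_mul_norm_eval_le hroots hu
    rw [hdeg, ← Function.iterate_succ_apply' (f := derivative)] at h
    have ih := ih (by omega)
    have hle : ((p.natDegree - (j + (i + 1)) : ℕ) : ℝ) ≤ (p.natDegree - (j + i) : ℕ) := by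
      exact_mod_cast (by omega : p.natDegree - (j + (i + 1)) ≤ p.natDegree - (j + i))
    set m : ℝ := ((p.natDegree - (j + i) : ℕ) : ℝ)
    have hm : 0 ≤ m := Nat.cast_nonneg _
    calc ((p.natDegree - (j + (i + 1)) : ℕ) : ℝ) ^ (i + 1) * ‖(derivative^[j] p).eval u‖
        ≤ m ^ (i + 1) * ‖(derivative^[j] p).eval u‖ := by gcongr
      _ = m * (m ^ i * ‖(derivative^[j] p).eval u‖) := by ring
      _ ≤ m * ((2 * ‖u - c‖) ^ i * ‖(derivative^[j + i] p).eval u‖) := by gcongr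
      _ = (2 * ‖u - c‖) ^ i * (m * ‖(derivative^[j + i] p).eval u‖) := by ring
      _ ≤ (2 * ‖u - c‖) ^ i * (2 * ‖u - c‖ * ‖(derivative^[j + i + 1] p).eval u‖) := by gcongr
      _ = _ := by rw [pow_succ, ← add_assoc]; ring

theorem exists_norm_eval_le_mul_pow (p : ℂ[X]) (c : ℂ) {R : ℝ} (hR : 0 < R) {d : ℕ}
    (hd : p.natDegree ≤ d) :
    ∃ M : ℝ, 0 ≤ M ∧ ∀ u, R ≤ ‖u - c‖ → ‖p.eval u‖ ≤ M * ‖u - c‖ ^ d := by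
  refine ⟨∑ i ∈ Finset.range (d + 1), ‖(taylor c p).coeff i‖ / R ^ (d - i),
    Finset.sum_nonneg fun i _ => by positivity, fun u hu => ?_⟩
  have h : p.eval u = ∑ i ∈ Finset.range (d + 1), (taylor c p).coeff i * (u - c) ^ i := by
    rw [← eval_eq_sum_range' (by rw [natDegree_taylor]; omega), taylor_eval, sub_add_cancel]
  rw [h, Finset.sum_mul]
  refine (norm_sum_le _ _).trans (Finset.sum_le_sum fun i hi => ?_)
  obtain ⟨e, rfl⟩ := Nat.exists_eq_add_of_le (Finset.mem_range_succ_iff.mp hi)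
  rw [norm_mul, norm_pow, Nat.add_sub_cancel_left, div_mul_eq_mul_div, le_div_iff₀ (by positivity)]
  calc ‖(taylor c p).coeff i‖ * ‖u - c‖ ^ i * R ^ e
      ≤ ‖(taylor c p).coeff i‖ * ‖u - c‖ ^ i * ‖u - c‖ ^ e := by gcongr
    _ = _ := by rw [pow_add]; ring

theorem exists_mul_pow_le_norm_eval {q : ℂ[X]} (hq : q ≠ 0) {c : ℂ} {R' R : ℝ} (hR' : 0 ≤ R')
    (hRR : R' < R) (hroots : ∀ z, q.eval z = 0 → z ∈ Metric.closedBall c R') :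
    ∃ a : ℝ, 0 < a ∧ ∀ u, R ≤ ‖u - c‖ → a * ‖u - c‖ ^ q.natDegree ≤ ‖q.eval u‖ := by
  have hs := IsAlgClosed.splits q
  have hR : 0 < R := by linarith
  set δ : ℝ := 1 - R' / R
  have hδ : 0 < δ := by
    have : R' / R < 1 := (div_lt_one hR).mpr hRR
    simp only [δ]; linarith
  have key (u : ℂ) (hu : R ≤ ‖u - c‖) (s : Multiset ℂ)
      (hroots : ∀ z ∈ s, z ∈ Metric.closedBall c R') :
      δ ^ Multiset.card s * ‖u - c‖ ^ Multiset.card s ≤ ‖(s.map (u - ·)).prod‖ := by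
    induction s using Multiset.induction_on with
    | empty => simp
    | cons b s ih =>
      have ih' := ih fun z hz => hroots z (Multiset.mem_cons_of_mem hz)
      have hb : ‖b - c‖ ≤ R' := by
        simpa [dist_eq_norm] using hroots b (Multiset.mem_cons_self b s)
      have hub : δ * ‖u - c‖ ≤ ‖u - b‖ := by
        have h1 := norm_sub_norm_le (u - c) (b - c)
        rw [sub_sub_sub_cancel_right] at h1
        have h2 : R' ≤ R' / R * ‖u - c‖ := by
          rw [div_mul_eq_mul_div, le_div_iff₀ hR]; gcongr
        simp only [δ]; linarith
      simp only [Multiset.map_cons, Multiset.prod_cons, norm_mul, Multiset.card_cons, pow_succ]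
      calc _ = (δ * ‖u - c‖) * (δ ^ Multiset.card s * ‖u - c‖ ^ Multiset.card s) := by ring
        _ ≤ _ := by gcongr
  refine ⟨‖q.leadingCoeff‖ * δ ^ q.natDegree, ?_, fun u hu => ?_⟩
  · have := norm_pos_iff.mpr (leadingCoeff_ne_zero.mpr hq)
    positivity
  · rw [hs.eval_eq_prod_roots, norm_mul, mul_assoc, hs.natDegree_eq_card_roots]
    exact mul_le_mul_of_nonneg_left
      (key u hu q.roots fun z hz => hroots z (isRoot_of_mem_roots hz)) (norm_nonneg _)

/-- Non-degeneracy bounds each `Q_j (u - c) ^ (k - j)` by a multiple of `Q_k` outside a disk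
whose interior contains the zeros of `Q_k`. -/
theorem NonDegenerate.exists_norm_eval_mul_pow_le {k : ℕ} {Q : ℕ → ℂ[X]} (hnd : NonDegenerate k Q)
    (hQ : Q k ≠ 0) {c : ℂ} {R' R : ℝ} (hR' : 0 ≤ R') (hRR : R' < R)
    (hroots : ∀ z, (Q k).eval z = 0 → z ∈ Metric.closedBall c R') :
    ∃ M : ℝ, 0 ≤ M ∧ ∀ j ≤ k, ∀ u, R ≤ ‖u - c‖ →
      ‖(Q j).eval u‖ * ‖u - c‖ ^ (k - j) ≤ M * ‖(Q k).eval u‖ := by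
  have hR : 0 < R := by linarith
  obtain ⟨a, ha, hlow⟩ := exists_mul_pow_le_norm_eval hQ hR' hRR hroots
  have hup (j : ℕ) : ∃ M : ℝ, 0 ≤ M ∧ (j ≤ k → ∀ u, R ≤ ‖u - c‖ →
      ‖(Q j).eval u‖ * ‖u - c‖ ^ (k - j) ≤ M * ‖u - c‖ ^ (Q k).natDegree) := by
    by_cases hj : j ≤ k
    · by_cases hQj : Q j = 0
      · exact ⟨0, le_rfl, fun _ u _ => by simp [hQj]⟩
      · have hdeg := hnd j hj hQj
        obtain ⟨M, hM0, hM⟩ := exists_norm_eval_le_mul_pow (Q j * (X - C c) ^ (k - j)) c hR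
          (d := (Q k).natDegree) (by
            rw [natDegree_mul hQj (pow_ne_zero _ (X_sub_C_ne_zero c)), natDegree_pow,
              natDegree_X_sub_C]
            omega)
        exact ⟨M, hM0, fun _ u hu => by simpa using hM u hu⟩
    · exact ⟨0, le_rfl, fun h => absurd h hj⟩
  choose M hM0 hM using hup
  refine ⟨(∑ j ∈ Finset.range (k + 1), M j) / a,
    div_nonneg (Finset.sum_nonneg fun j _ => hM0 j) ha.le, fun j hj u hu => ?_⟩
  have hle : M j ≤ ∑ j ∈ Finset.range (k + 1), M j :=
    Finset.single_le_sum (f := M) (fun j _ => hM0 j) (Finset.mem_range_succ_iff.mpr hj)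
  rw [div_mul_eq_mul_div, le_div_iff₀ ha]
  calc _ ≤ M j * ‖u - c‖ ^ (Q k).natDegree * a :=
        mul_le_mul_of_nonneg_right (hM j hj u hu) ha.le
    _ = M j * (a * ‖u - c‖ ^ (Q k).natDegree) := by ring
    _ ≤ _ := mul_le_mul hle (hlow u hu) (by positivity) ((hM0 j).trans hle)

theorem NonDegenerate.exists_tGeInvariant_closedBall {k : ℕ} {Q : ℕ → ℂ[X]}
    (hnd : NonDegenerate k Q) (hQ : Q k ≠ 0) {c : ℂ} {R' R : ℝ} (hR' : 0 ≤ R') (hRR : R' < R)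
    (hroots : ∀ z, (Q k).eval z = 0 → z ∈ Metric.closedBall c R') :
    ∃ n, TGeInvariant (diffOp k Q) n (Metric.closedBall c R) := by
  obtain ⟨M, hM0, hM⟩ := hnd.exists_norm_eval_mul_pow_le hQ hR' hRR hroots
  obtain ⟨L, hL⟩ := exists_nat_gt (k * (2 ^ k * M))
  refine ⟨k + L + 1, fun p _ hdeg hp => Or.inr fun u hTu => ?_⟩
  by_contra hu
  have huR : R < ‖u - c‖ := by simpa [dist_eq_norm] using hu
  set m : ℕ := p.natDegree - k with hm
  have hm1 : (1 : ℝ) ≤ m := by exact_mod_cast (by omega : 1 ≤ m)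
  have hmL : (L : ℝ) ≤ m := by exact_mod_cast (by omega : L ≤ m)
  have hQu : 0 < ‖(Q k).eval u‖ := norm_pos_iff.mpr fun h => by
    have := hroots u h
    rw [Metric.mem_closedBall, dist_eq_norm] at this
    linarith
  have hpk : 0 < ‖(derivative^[k] p).eval u‖ := norm_pos_iff.mpr fun h =>
    hu ((iterate_derivative_roots_mem_closedBall hp (by omega)).2 u h)
  have hterm : ∀ j ∈ Finset.range k, m * ‖(Q j * derivative^[j] p).eval u‖ ≤
      2 ^ k * M * (‖(Q k).eval u‖ * ‖(derivative^[k] p).eval u‖) := by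
    intro j hj
    have hjk := Finset.mem_range.mp hj
    have h1 := pow_mul_norm_eval_iterate_derivative_le hp hu j (k - j) (by omega)
    rw [Nat.add_sub_cancel' hjk.le] at h1
    have h2 := hM j hjk.le u huR.le
    have h3 : (m : ℝ) ≤ (m : ℝ) ^ (k - j) := le_self_pow₀ hm1 (by omega)
    have h4 : (2 : ℝ) ^ (k - j) ≤ 2 ^ k := pow_le_pow_right₀ one_le_two (Nat.sub_le _ _)
    rw [eval_mul, norm_mul]
    set A := ‖(derivative^[j] p).eval u‖
    set B := ‖(derivative^[k] p).eval u‖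
    calc m * (‖(Q j).eval u‖ * A) ≤ (m : ℝ) ^ (k - j) * (‖(Q j).eval u‖ * A) := by gcongr
      _ = ‖(Q j).eval u‖ * ((m : ℝ) ^ (k - j) * A) := by ring
      _ ≤ ‖(Q j).eval u‖ * ((2 * ‖u - c‖) ^ (k - j) * B) := by gcongr
      _ = 2 ^ (k - j) * (‖(Q j).eval u‖ * ‖u - c‖ ^ (k - j)) * B := by rw [mul_pow]; ring
      _ ≤ 2 ^ k * (M * ‖(Q k).eval u‖) * B := by gcongr
      _ = _ := by ring
  have hsum : (Q k * derivative^[k] p).eval u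
      = -∑ j ∈ Finset.range k, (Q j * derivative^[j] p).eval u := by
    rw [diffOp, Finset.sum_range_succ, eval_add, eval_finsetSum] at hTu
    exact eq_neg_of_add_eq_zero_right hTu
  have hbound : m * (‖(Q k).eval u‖ * ‖(derivative^[k] p).eval u‖) ≤
      k * (2 ^ k * M) * (‖(Q k).eval u‖ * ‖(derivative^[k] p).eval u‖) := by
    calc _ = m * ‖∑ j ∈ Finset.range k, (Q j * derivative^[j] p).eval u‖ := by
          rw [← norm_mul, ← eval_mul, hsum, norm_neg]
      _ ≤ m * ∑ j ∈ Finset.range k, ‖(Q j * derivative^[j] p).eval u‖ := by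
          gcongr; exact norm_sum_le _ _
      _ = ∑ j ∈ Finset.range k, m * ‖(Q j * derivative^[j] p).eval u‖ := Finset.mul_sum _ _ _
      _ ≤ _ := Finset.sum_le_sum hterm
      _ = _ := by rw [Finset.sum_const, Finset.card_range, nsmul_eq_mul]; ring
  have := le_of_mul_le_mul_right hbound (mul_pos hQu hpk)
  linarith

theorem limit_minimal_set_eq_fundamental_polygon (k : ℕ) (hk : 1 ≤ k)
    (Q : ℕ → Polynomial ℂ) (hQk : 1 ≤ (Q k).natDegree) (hnd : NonDegenerate k Q) :
    (⋂ n : ℕ, ⋂₀ {S : Set ℂ | S.Nonempty ∧ IsClosed S ∧ TGeInvariant (diffOp k Q) n S}) =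
      convexHull ℝ {z : ℂ | (Q k).eval z = 0} := by
  have hQ : Q k ≠ 0 := by
    intro h
    simp [h] at hQk
  have hfin : {z : ℂ | (Q k).eval z = 0}.Finite := finite_setOfPred_isRoot hQ
  have hne : {z : ℂ | (Q k).eval z = 0}.Nonempty :=
    IsAlgClosed.exists_root (Q k) (natDegree_pos_iff_degree_pos.mp hQk).ne'
  apply Set.Subset.antisymm
  · intro z hz
    by_contra hzK
    obtain ⟨c, R', R, hR', hRR, hK, hzR⟩ := exists_closedBall_of_notMem hne.convexHull
      (hfin.isCompact_convexHull (𝕜 := ℝ)) (convex_convexHull ℝ _) hzK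
    obtain ⟨n, hn⟩ := hnd.exists_tGeInvariant_closedBall hQ hR' hRR
      fun w hw => hK (subset_convexHull ℝ _ hw)
    exact hzR (Set.mem_iInter.mp hz n _
      ⟨Metric.nonempty_closedBall.mpr (by linarith), Metric.isClosed_closedBall, hn⟩)
  · exact Set.subset_iInter fun n => Set.subset_sInter fun S hS =>
      TGeInvariant.convexHull_subset hk hQ hS.1 hS.2.1 hS.2.2
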